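/- Let r ≥ 2 be an integer, let ε be a real number with 0 < ε < 2/(r(r+1)), and set δ = ε²/32. Then there exists an integer n_0 such that for all integers n > n_0 the following holds: if G is a simple graph with n vertices and m edges, m > t_r(n) − δ·n², and every r-clique R of G satisfies Σ_{u∈R} d(u) ≤ (1−ε)·(r−1)·n, then the number of vertices u of G with d(u) ≤ ((r−1)/r − ε/2)·n is less than ε·n. -/

import Mathlib

open Finset

/-- The number of edges of a simple graph. -/
noncomputable def edgeCount {V : Type*} (G : SimpleGraph V) : ℕ := Nat.card G.edgeSet

/-- The degree of a vertex. -/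
noncomputable def deg {V : Type*} (G : SimpleGraph V) (u : V) : ℕ := Nat.card (G.neighborSet u)

/-- The number of edges `t_r(n)` of the Turán graph `T_r(n)`. -/
noncomputable def turanEdges (r n : ℕ) : ℕ := edgeCount (SimpleGraph.turanGraph n r)

/-- `v 0, ..., v (k-1)` is a 𝔓-sequence in `G`: each `v i` lies in the common
neighbourhood of the previous terms and has maximum degree among the vertices of
that common neighbourhood (for `i = 0`, the common neighbourhood is the whole
vertex set, so `v 0` is a vertex of maximum degree in `G`). -/
def IsPSeq {V : Type*} (G : SimpleGraph V) {k : ℕ} (v : Fin k → V) : Prop :=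
  ∀ i : Fin k,
    (∀ j : Fin k, j < i → G.Adj (v j) (v i)) ∧
    ∀ u : V, (∀ j : Fin k, j < i → G.Adj (v j) u) → deg G u ≤ deg G (v i)

/-- Greedy degree bound inside `U`. Write `d v` for the number of neighbours of `v` in `U`. If every
`j`-clique `R` in `A ⊆ U` satisfies `b ≤ ∑ v ∈ R, (#U - d v)` and `d ≤ B` on `A`, then the sum
of `d` over `A` is at most `B (#A - b) + #U b - b² / j`. -/
theorem sum_card_adj_le_of_forall_isNClique {V : Type*} [DecidableEq V] (G : SimpleGraph V)
    [DecidableRel G.Adj] (U : Finset V) (j : ℕ) (hj : 1 ≤ j) :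
    ∀ A ⊆ U, ∀ b B : ℝ, 0 ≤ b → b ≤ #A →
      (∀ v ∈ A, (#(U.filter (G.Adj v)) : ℝ) ≤ B) →
      (∀ R ⊆ A, G.IsNClique j R → b ≤ ∑ v ∈ R, ((#U : ℝ) - #(U.filter (G.Adj v)))) →
      ∑ v ∈ A, (#(U.filter (G.Adj v)) : ℝ) ≤ B * (#A - b) + #U * b - b ^ 2 / j := by
  induction j, hj using Nat.le_induction with
  | base =>
    intro A hA b B hb hbA hB hR
    rcases A.eq_empty_or_nonempty with rfl | hne
    · have : b = 0 := le_antisymm (by simpa using hbA) hb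
      simp [this]
    obtain ⟨v, hv, hmax⟩ := A.exists_max_image (fun v => #(U.filter (G.Adj v))) hne
    have h1 : b ≤ (#U : ℝ) - #(U.filter (G.Adj v)) := by
      simpa using hR {v} (by simpa using hv) (by simp [SimpleGraph.isNClique_iff])
    have h2 : ∑ u ∈ A, (#(U.filter (G.Adj u)) : ℝ) ≤ #A * (#(U.filter (G.Adj v)) : ℝ) := by
      rw [← nsmul_eq_mul]
      exact Finset.sum_le_card_nsmul _ _ _ fun u hu => by exact_mod_cast hmax u hu
    have h3 := mul_le_mul_of_nonneg_right (hB v hv) (sub_nonneg.2 hbA)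
    have h4 := mul_le_mul_of_nonneg_right h1 hb
    norm_num
    nlinarith
  | succ j hj ih =>
    intro A hA b B hb hbA hB hR
    have hj0 : (0 : ℝ) < j := by exact_mod_cast hj
    rcases A.eq_empty_or_nonempty with rfl | hne
    · have : b = 0 := le_antisymm (by simpa using hbA) hb
      simp [this]
    obtain ⟨v, hv, hmax⟩ := A.exists_max_image (fun v => #(U.filter (G.Adj v))) hne
    set D : ℝ := (#(U.filter (G.Adj v)) : ℝ) with hD
    have hmax' : ∀ u ∈ A, (#(U.filter (G.Adj u)) : ℝ) ≤ D := fun u hu => by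
      rw [hD]; exact_mod_cast hmax u hu
    have h3 := mul_le_mul_of_nonneg_right (hB v hv) (sub_nonneg.2 hbA)
    push_cast
    rcases le_or_gt b (#U - D) with h1 | h1
    · have h2 : ∑ u ∈ A, (#(U.filter (G.Adj u)) : ℝ) ≤ #A * D := by
        rw [← nsmul_eq_mul]
        exact Finset.sum_le_card_nsmul _ _ _ hmax'
      have h4 := mul_le_mul_of_nonneg_right h1 hb
      have h5 : b ^ 2 / ((j : ℝ) + 1) ≤ b ^ 2 := div_le_self (by positivity) (by linarith)
      nlinarith
    · have hsplit : (#(A.filter (G.Adj v)) : ℝ) + #(A.filter fun u => ¬ G.Adj v u) = #A := by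
        exact_mod_cast Finset.card_filter_add_card_filter_not (s := A) (G.Adj v)
      have hsplitU : D + #(U.filter fun u => ¬ G.Adj v u) = #U := by
        rw [hD]
        exact_mod_cast Finset.card_filter_add_card_filter_not (s := U) (G.Adj v)
      have hx : (#(A.filter fun u => ¬ G.Adj v u) : ℝ) ≤ #(U.filter fun u => ¬ G.Adj v u) := by
        exact_mod_cast Finset.card_le_card (Finset.filter_subset_filter _ hA)
      have hrec := ih (A.filter (G.Adj v)) ((Finset.filter_subset _ _).trans hA)
        (b - (#U - D)) D (by linarith) (by linarith)
        (fun u hu => hmax' u (Finset.mem_filter.1 hu).1) (by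
          intro R hRA hRc
          have hvR : v ∉ R := fun h => (G.loopless.irrefl v) (Finset.mem_filter.1 (hRA h)).2
          have := hR (insert v R)
            (Finset.insert_subset hv (hRA.trans (Finset.filter_subset _ _)))
            (hRc.insert fun u hu => (Finset.mem_filter.1 (hRA hu)).2)
          rw [Finset.sum_insert hvR] at this
          linarith)
      have hnon : ∑ u ∈ A.filter (fun u => ¬ G.Adj v u), (#(U.filter (G.Adj u)) : ℝ)
          ≤ #(A.filter fun u => ¬ G.Adj v u) * D := by
        rw [← nsmul_eq_mul]
        exact Finset.sum_le_card_nsmul _ _ _ fun u hu => hmax' u (Finset.mem_filter.1 hu).1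
      rw [← Finset.sum_filter_add_sum_filter_not A (G.Adj v)]
      have hconv : b ^ 2 / ((j : ℝ) + 1) ≤ (#U - D) ^ 2 + (b - (#U - D)) ^ 2 / j := by
        rw [← sub_nonneg]
        have : (#U - D) ^ 2 + (b - (#U - D)) ^ 2 / j - b ^ 2 / ((j : ℝ) + 1)
            = (j * (#U - D) - (b - (#U - D))) ^ 2 / (j * (j + 1)) := by
          field_simp
          ring
        rw [this]
        positivity
      nlinarith

/-- If every `r`-clique in `U` has degree sum (inside `U`) at most `(r - 1) #U`, then the total
degree inside `U` is at most `(r - 1) / r * #U ^ 2`. -/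
theorem sum_card_adj_le_of_forall_isNClique_sum_le {V : Type*} [DecidableEq V]
    (G : SimpleGraph V) [DecidableRel G.Adj] (U : Finset V) (r : ℕ) (hr : 1 ≤ r)
    (h : ∀ R ⊆ U, G.IsNClique r R →
      ∑ v ∈ R, (#(U.filter (G.Adj v)) : ℝ) ≤ ((r : ℝ) - 1) * #U) :
    ∑ v ∈ U, (#(U.filter (G.Adj v)) : ℝ) ≤ ((r : ℝ) - 1) / r * (#U : ℝ) ^ 2 := by
  have hr0 : (0 : ℝ) < r := by exact_mod_cast hr
  have key := sum_card_adj_le_of_forall_isNClique G U r hr U subset_rfl #U #U (by positivity)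
    le_rfl (fun v _ => by exact_mod_cast Finset.card_filter_le _ _) (by
      intro R hR hRc
      have := h R hR hRc
      rw [Finset.sum_sub_distrib, Finset.sum_const, hRc.card_eq, nsmul_eq_mul]
      linarith)
  have e : ((r : ℝ) - 1) / r * (#U : ℝ) ^ 2 = #U * #U - (#U : ℝ) ^ 2 / r := by
    field_simp
  rw [e]
  linarith

/-- Deleting a vertex set `M` lowers the total degree by at most twice the degree sum of `M`. -/
theorem sum_degree_le_sum_card_adj_compl {V : Type*} [Fintype V] [DecidableEq V]
    (G : SimpleGraph V) [DecidableRel G.Adj] (M : Finset V) :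
    ∑ v, G.degree v ≤ ∑ v ∈ Mᶜ, #(Mᶜ.filter (G.Adj v)) + 2 * ∑ v ∈ M, G.degree v := by
  have hdeg : ∀ v, G.degree v = #(Mᶜ.filter (G.Adj v)) + #(M.filter (G.Adj v)) := fun v => by
    rw [← SimpleGraph.card_neighborFinset_eq_degree, SimpleGraph.neighborFinset_eq_filter,
      ← Finset.card_union_of_disjoint
        (Finset.disjoint_filter_filter (disjoint_compl_left (a := M))), ← Finset.filter_union]
    congr 2
    rw [Finset.union_comm, Finset.union_compl]
  have hswap : ∑ v ∈ Mᶜ, #(M.filter (G.Adj v)) = ∑ w ∈ M, #(Mᶜ.filter (G.Adj w)) := by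
    have := Finset.sum_card_bipartiteAbove_eq_sum_card_bipartiteBelow (s := Mᶜ) (t := M) G.Adj
    simpa only [Finset.bipartiteAbove, Finset.bipartiteBelow, G.adj_comm] using this
  have hle : ∑ w ∈ M, #(Mᶜ.filter (G.Adj w)) ≤ ∑ w ∈ M, G.degree w :=
    Finset.sum_le_sum fun w _ => by rw [hdeg w]; omega
  rw [← Finset.sum_add_sum_compl M, Finset.sum_congr rfl fun v (_ : v ∈ Mᶜ) => hdeg v,
    Finset.sum_add_distrib, hswap]
  omega

theorem edgeCount_eq_card_edgeFinset {V : Type*} (G : SimpleGraph V) [Fintype G.edgeSet] :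
    edgeCount G = #G.edgeFinset := by
  rw [edgeCount, Nat.card_eq_fintype_card, SimpleGraph.edgeFinset_card]

theorem deg_eq_degree {V : Type*} (G : SimpleGraph V) (u : V) [Fintype (G.neighborSet u)] :
    deg G u = G.degree u := by
  rw [deg, Nat.card_eq_fintype_card, SimpleGraph.card_neighborSet_eq_degree]

theorem le_turanEdges (r n : ℕ) (hr : 1 ≤ r) :
    ((r : ℝ) - 1) / (2 * r) * n ^ 2 - (r ^ 2 + 1) ≤ turanEdges r n := by
  have hr0 : (1 : ℝ) ≤ r := by exact_mod_cast hr
  rw [turanEdges, edgeCount_eq_card_edgeFinset, SimpleGraph.card_edgeFinset_turanGraph]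
  have hmod : n % r < r := Nat.mod_lt _ hr
  have hmodn : n % r ≤ n := Nat.mod_le _ _
  have hdiv := Nat.lt_div_mul_add (a := (n ^ 2 - (n % r) ^ 2) * (r - 1)) (b := 2 * r) (by omega)
  have hdiv' : ((n : ℝ) ^ 2 - ((n % r : ℕ) : ℝ) ^ 2) * (r - 1)
      < (((n ^ 2 - (n % r) ^ 2) * (r - 1) / (2 * r) : ℕ) : ℝ) * (2 * r) + 2 * r := by
    have := (Nat.cast_lt (α := ℝ)).2 hdiv
    push_cast [Nat.cast_sub hr, Nat.cast_sub (Nat.pow_le_pow_left hmodn 2)] at this ⊢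
    exact this
  have hm : ((n % r : ℕ) : ℝ) ^ 2 ≤ r ^ 2 := by
    exact_mod_cast Nat.pow_le_pow_left hmod.le 2
  have hq : ((r : ℝ) - 1) / (2 * r) * n ^ 2 - (r ^ 2 + 1)
      ≤ (((n ^ 2 - (n % r) ^ 2) * (r - 1) / (2 * r) : ℕ) : ℝ) := by
    rw [div_mul_eq_mul_div, sub_le_iff_le_add, div_le_iff₀ (by positivity)]
    nlinarith [mul_le_mul_of_nonneg_right hm (sub_nonneg.2 hr0),
      mul_nonneg (sq_nonneg (r : ℝ)) (sub_nonneg.2 hr0), sq_nonneg (r : ℝ)]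
  push_cast
  have : (0 : ℝ) ≤ ((n % r).choose 2 : ℝ) := by positivity
  linarith

/-- Let r ≥ 2 and 0 < ε < 2/(r(r+1)), and set δ = ε²/32. Then there is
n₀ such that for all n > n₀: if G has n vertices, m > t_r(n) − δ·n² edges, and every
r-clique of G has degree sum at most (1−ε)·(r−1)·n, then fewer than ε·n vertices u of G
satisfy d(u) ≤ ((r−1)/r − ε/2)·n. -/
theorem few_small_degrees (r : ℕ) (hr : 2 ≤ r) (ε : ℝ) (hε1 : 0 < ε)
    (hε2 : ε < 2 / (r * (r + 1))) :
    ∃ n₀ : ℕ, ∀ n m : ℕ, n₀ < n →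
      ∀ G : SimpleGraph (Fin n), edgeCount G = m →
        (turanEdges r n : ℝ) - ε ^ 2 / 32 * n ^ 2 < m →
        (∀ R : Finset (Fin n), G.IsNClique r R →
          (∑ u ∈ R, (deg G u : ℝ)) ≤ (1 - ε) * (r - 1) * n) →
        ((Finset.univ.filter
            fun u : Fin n => (deg G u : ℝ) ≤ ((r - 1) / r - ε / 2) * n).card : ℝ)
          < ε * n := by
  classical
  refine ⟨⌈16 * ((r : ℝ) ^ 2 + 2) / ε⌉₊, fun n m hn G hm hmt hR => ?_⟩
  have hr0 : (2 : ℝ) ≤ r := by exact_mod_cast hr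
  have hX : 16 * ((r : ℝ) ^ 2 + 2) ≤ ε * n := by
    have := (Nat.le_ceil _).trans (Nat.cast_le (α := ℝ).2 hn.le)
    rw [div_le_iff₀ hε1] at this
    linarith
  by_contra! hbig
  set p : ℝ := (r - 1) / r with hp
  have hp1 : p ≤ 1 := by rw [hp, div_le_one (by linarith)]; linarith
  have hk1 := Nat.le_ceil (ε * n / 2)
  have hk2 := Nat.ceil_lt_add_one (a := ε * n / 2) (by positivity)
  set k : ℕ := ⌈ε * n / 2⌉₊
  have hr2 : 0 ≤ (r : ℝ) ^ 2 := by positivity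
  obtain ⟨M, hMs, hMk⟩ := Finset.exists_subset_card_eq (n := k) (by
    have : (k : ℝ) ≤ _ := le_trans (by linarith) hbig
    exact_mod_cast this)
  have hU : (#Mᶜ : ℝ) = n - k := by
    have := Finset.card_add_card_compl M
    rw [hMk, Fintype.card_fin] at this
    have : (k : ℝ) + #Mᶜ = n := by exact_mod_cast this
    linarith
  have hub := sum_card_adj_le_of_forall_isNClique_sum_le G Mᶜ r (by omega) (by
    intro R _ hRc
    calc ∑ v ∈ R, (#(Mᶜ.filter (G.Adj v)) : ℝ) ≤ ∑ v ∈ R, (deg G v : ℝ) := by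
          refine Finset.sum_le_sum fun v _ => ?_
          rw [deg_eq_degree, ← SimpleGraph.card_neighborFinset_eq_degree,
            SimpleGraph.neighborFinset_eq_filter]
          exact_mod_cast Finset.card_le_card (Finset.filter_subset_filter _ (Finset.subset_univ _))
      _ ≤ (1 - ε) * (r - 1) * n := hR R hRc
      _ ≤ ((r : ℝ) - 1) * #Mᶜ := by
          rw [hU]
          nlinarith)
  rw [← hp, hU] at hub
  have hlow : (2 * m : ℝ) ≤ ∑ v ∈ Mᶜ, (#(Mᶜ.filter (G.Adj v)) : ℝ)
      + 2 * ∑ v ∈ M, (G.degree v : ℝ) := by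
    have := sum_degree_le_sum_card_adj_compl G M
    rw [SimpleGraph.sum_degrees_eq_twice_card_edges, ← edgeCount_eq_card_edgeFinset, hm] at this
    exact_mod_cast this
  have hM : ∑ v ∈ M, (G.degree v : ℝ) ≤ k * ((p - ε / 2) * n) := by
    rw [← hMk, ← nsmul_eq_mul]
    refine Finset.sum_le_card_nsmul _ _ _ fun v hv => ?_
    rw [← deg_eq_degree]
    exact (Finset.mem_filter.1 (hMs hv)).2
  have ht := le_turanEdges r n (by omega)
  have e : ((r : ℝ) - 1) / (2 * r) = p / 2 := by rw [hp]; field_simp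
  rw [e] at ht
  have hpk : p * (k : ℝ) ^ 2 ≤ (k : ℝ) ^ 2 := mul_le_of_le_one_left (by positivity) hp1
  have hprod : 0 ≤ ((k : ℝ) - ε * n / 2) * (ε * n / 2 + 1 - k) :=
    mul_nonneg (by linarith) (by linarith)
  have hXX : 16 * ((r : ℝ) ^ 2 + 2) * (ε * n) ≤ (ε * n) * (ε * n) :=
    mul_le_mul_of_nonneg_right hX (by positivity)
  nlinarith
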